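/- For all integers k ≥ 0 and j ≥ 0 with k + j ≥ 2, let g_3 = z · (x + y − k·z)(x + y − (k−1)·z)(x + y − (k−2)·z) · ∏_{s=−j}^{k+j} (x − s·z)(y − s·z) ∈ S, the defining polynomial of the cone over the arrangement A_3 obtained from the grid by adding the three diagonal lines x+y = c·z for c = k, k−1, k−2. Then there exist three ℝ-linearly independent homogeneous linear forms ℓ_1, ℓ_2, ℓ_3 ∈ S and three derivations θ_1, θ_2, θ_3 ∈ D_0(g_3), each homogeneous of degree k+2j+3, such that the sequence 0 → S → S^3 → D_0(g_3) → 0 is exact, where the first map sends v to (ℓ_1·v, ℓ_2·v, ℓ_3·v) and the second sends (a_1,a_2,a_3) to Σ_i a_i·θ_i. (Equivalently, F_3 := T_{A_3}(k+2j+3) ≅ T_{ℙ²}(−1).) -/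

import Mathlib

open MvPolynomial

noncomputable section

abbrev S := MvPolynomial (Fin 3) ℝ

/-- The module of logarithmic derivations annihilating `f`. -/
def D0 (f : S) : Submodule S (Derivation ℝ S S) where
  carrier := {θ | θ f = 0}
  add_mem' := by
    intro a b ha hb
    simp only [Set.mem_setOf_eq] at *
    simp [ha, hb]
  zero_mem' := by simp
  smul_mem' := by
    intro c θ hθ
    simp only [Set.mem_setOf_eq] at *
    simp [hθ]

/-- A derivation is homogeneous of degree `d` if its values on the variables are
homogeneous of degree `d`. -/
def IsHomogDer (θ : Derivation ℝ S S) (d : ℕ) : Prop :=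
  ∀ i : Fin 3, (θ (X i)).IsHomogeneous d


/-- Defining polynomial of the cone over the arrangement `A_3`: the grid plus the three
diagonal lines `x + y = c·z`, `c = k, k-1, k-2`. -/
def g3Poly (j k : ℕ) : S :=
  X 2 * (X 0 + X 1 - C (k : ℝ) * X 2) * (X 0 + X 1 - C ((k : ℝ) - 1) * X 2) *
    (X 0 + X 1 - C ((k : ℝ) - 2) * X 2) *
    ∏ s ∈ Finset.Icc (-(j : ℤ)) ((k : ℤ) + j),
      ((X 0 - C (s : ℝ) * X 2) * (X 1 - C (s : ℝ) * X 2))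


/-- Divisibility by `L` is tested by a substitution `σ` killing `L`. -/
lemma dvd_iff_sub (L : S) (σ : S →ₐ[ℝ] S) (h0 : σ L = 0)
    (h : ∀ i, L ∣ X i - σ (X i)) (f : S) : L ∣ f ↔ σ f = 0 := by
  constructor
  · rintro ⟨q, rfl⟩
    simp [h0]
  · intro hf
    have key : ∀ f : S, L ∣ f - σ f := by
      intro f
      induction f using MvPolynomial.induction_on with
      | C a => simp [← MvPolynomial.algebraMap_eq]
      | add p q hp hq =>
        have := dvd_add hp hq
        rw [map_add]
        convert this using 1
        ring
      | mul_X p i hp =>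
        have := dvd_add (hp.mul_right (X i)) ((h i).mul_left (σ p))
        rw [map_mul]
        convert this using 1
        ring
    have := key f
    rwa [hf, sub_zero] at this

def sub0 (s : ℝ) : S →ₐ[ℝ] S := aeval ![C s * X 2, X 1, X 2]
def sub1 (s : ℝ) : S →ₐ[ℝ] S := aeval ![X 0, C s * X 2, X 2]
def sub2 : S →ₐ[ℝ] S := aeval ![X 0, X 1, 0]
def subd (c : ℝ) : S →ₐ[ℝ] S := aeval ![X 0, C c * X 2 - X 0, X 2]

lemma sub0_C (s a : ℝ) : sub0 s (C a) = C a := (sub0 s).commutes a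
lemma sub1_C (s a : ℝ) : sub1 s (C a) = C a := (sub1 s).commutes a
lemma sub2_C (a : ℝ) : sub2 (C a) = C a := sub2.commutes a
lemma subd_C (s a : ℝ) : subd s (C a) = C a := (subd s).commutes a
lemma sub0_0 (s : ℝ) : sub0 s (X 0) = C s * X 2 := by simp [sub0]
lemma sub0_1 (s : ℝ) : sub0 s (X 1) = X 1 := by simp [sub0]
lemma sub0_2 (s : ℝ) : sub0 s (X 2) = X 2 := by simp [sub0]
lemma sub1_0 (s : ℝ) : sub1 s (X 0) = X 0 := by simp [sub1]
lemma sub1_1 (s : ℝ) : sub1 s (X 1) = C s * X 2 := by simp [sub1]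
lemma sub1_2 (s : ℝ) : sub1 s (X 2) = X 2 := by simp [sub1]
lemma sub2_0 : sub2 (X 0) = X 0 := by simp [sub2]
lemma sub2_1 : sub2 (X 1) = X 1 := by simp [sub2]
lemma sub2_2 : sub2 (X 2) = 0 := by simp [sub2]
lemma subd_0 (s : ℝ) : subd s (X 0) = X 0 := by simp [subd]
lemma subd_1 (s : ℝ) : subd s (X 1) = C s * X 2 - X 0 := by simp [subd]
lemma subd_2 (s : ℝ) : subd s (X 2) = X 2 := by simp [subd]

attribute [simp] sub0_C sub1_C sub2_C subd_C sub0_0 sub0_1 sub0_2 sub1_0 sub1_1 sub1_2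
  sub2_0 sub2_1 sub2_2 subd_0 subd_1 subd_2

lemma dvd0 (s : ℝ) (f : S) : X 0 - C s * X 2 ∣ f ↔ sub0 s f = 0 := by
  apply dvd_iff_sub
  · simp
  · intro i
    fin_cases i <;> simp

lemma dvd1 (s : ℝ) (f : S) : X 1 - C s * X 2 ∣ f ↔ sub1 s f = 0 := by
  apply dvd_iff_sub
  · simp
  · intro i
    fin_cases i <;> simp

lemma dvd2 (f : S) : X 2 ∣ f ↔ sub2 f = 0 := by
  apply dvd_iff_sub
  · simp
  · intro i
    fin_cases i <;> simp

lemma dvdd (c : ℝ) (f : S) : X 0 + X 1 - C c * X 2 ∣ f ↔ subd c f = 0 := by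
  apply dvd_iff_sub
  · simp
  · intro i
    fin_cases i <;> simp
    exact dvd_of_eq (by ring)

/-- nonvanishing of a linear form, tested at a point -/
lemma ne_zero_of_eval (f : S) (v : Fin 3 → ℝ) (h : eval v f ≠ 0) : f ≠ 0 := by
  rintro rfl
  simp at h

/-- The grid polynomial in one direction. -/
def gp (k j : ℕ) (t : S) : S := ∏ s ∈ Finset.Icc (-(j : ℤ)) ((k : ℤ) + j), (t - C (s : ℝ) * X 2)

lemma gp_range (k j : ℕ) (t : S) :
    gp k j t = ∏ i ∈ Finset.range (k + 2 * j + 1), (t - (C (i : ℝ) - C (j : ℝ)) * X 2) := by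
  unfold gp
  symm
  refine Finset.prod_bij (fun i _ => (i : ℤ) - j) ?_ ?_ ?_ ?_
  · intro i hi
    simp at hi ⊢
    omega
  · intro a _ b _ h
    simpa using h
  · intro b hb
    simp at hb
    refine ⟨(b + j).toNat, ?_, ?_⟩
    · simp
      omega
    · have : 0 ≤ b + j := by omega
      simp [this]
  · intro i _
    simp

lemma gp_reflect (k j : ℕ) (t : S) :
    gp k j (C (k : ℝ) * X 2 - t) = (-1) ^ (k + 2 * j + 1) * gp k j t := by
  rw [gp_range, gp_range, ← Finset.prod_range_reflect]
  conv_rhs => rw [← Finset.card_range (k + 2 * j + 1), ← Finset.prod_const,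
    Finset.card_range, ← Finset.prod_mul_distrib]
  apply Finset.prod_congr rfl
  intro i hi
  simp at hi
  have : ((k + 2 * j + 1 - 1 - i : ℕ) : ℝ) = k + 2 * j - i := by
    have : i ≤ k + 2 * j := by omega
    rw [show k + 2 * j + 1 - 1 - i = k + 2 * j - i by omega]
    push_cast [this]
    ring
  rw [this]
  simp only [map_sub, map_add, map_mul, map_ofNat]
  ring

lemma gp_shift (k j : ℕ) (t : S) :
    gp k j (t + X 2) * (t - (C (k : ℝ) + C (j : ℝ)) * X 2)
      = (t + (C (j : ℝ) + 1) * X 2) * gp k j t := by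
  rw [gp_range, gp_range]
  have h1 := Finset.prod_range_succ (fun i : ℕ => t - (C (i : ℝ) - 1 - C (j : ℝ)) * X 2)
    (k + 2 * j + 1)
  have h2 := Finset.prod_range_succ' (fun i : ℕ => t - (C (i : ℝ) - 1 - C (j : ℝ)) * X 2)
    (k + 2 * j + 1)
  rw [h1] at h2
  push_cast at h2
  simp only [map_add, map_mul, map_one, map_ofNat, map_zero] at h2
  have e1 : ∀ i : ℕ, (t + X 2 - (C (i : ℝ) - C (j : ℝ)) * X 2 : S)
    = t - (C (i : ℝ) - 1 - C (j : ℝ)) * X 2 := by intro i; ring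
  have e2 : ∀ i : ℕ, (t - (C (i : ℝ) - C (j : ℝ)) * X 2 : S)
    = t - (C (i : ℝ) + 1 - 1 - C (j : ℝ)) * X 2 := by intro i; ring
  simp only [e1, e2]
  linear_combination h2

lemma gp_ne_zero (k j : ℕ) : gp k j (X 0) ≠ 0 := by
  unfold gp
  rw [Finset.prod_ne_zero_iff]
  intro s _
  apply ne_zero_of_eval _ ![1, 0, 0]
  simp

lemma subd_gp0 (k j : ℕ) (c : ℝ) : subd c (gp k j (X 0)) = gp k j (X 0) := by
  simp [gp, map_prod]

lemma subd_gp1 (k j : ℕ) (c : ℝ) : subd c (gp k j (X 1)) = gp k j (C c * X 2 - X 0) := by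
  simp [gp, map_prod]

lemma gpd0 (k j : ℕ) : subd (k : ℝ) (gp k j (X 1)) = (-1) ^ (k + 2 * j + 1) * gp k j (X 0) := by
  rw [subd_gp1, gp_reflect]

lemma gpd1 (k j : ℕ) : (X 0 - (C (k : ℝ) + C (j : ℝ)) * X 2) * subd ((k : ℝ) - 1) (gp k j (X 1))
    = (-1) ^ (k + 2 * j + 1) * (X 0 + (C (j : ℝ) + 1) * X 2) * gp k j (X 0) := by
  rw [subd_gp1]
  have := gp_reflect k j (X 0 + X 2)
  rw [show (C ((k : ℝ) - 1) * X 2 - X 0 : S) = C (k : ℝ) * X 2 - (X 0 + X 2) by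
    simp only [map_sub, map_one]; ring, this]
  linear_combination (-1) ^ (k + 2 * j + 1) * gp_shift k j (X 0)

lemma gpd2 (k j : ℕ) : (X 0 - (C (k : ℝ) + C (j : ℝ)) * X 2) *
    (X 0 - (C (k : ℝ) + C (j : ℝ) - 1) * X 2) * subd ((k : ℝ) - 2) (gp k j (X 1))
    = (-1) ^ (k + 2 * j + 1) * (X 0 + (C (j : ℝ) + 1) * X 2) * (X 0 + (C (j : ℝ) + 2) * X 2)
      * gp k j (X 0) := by
  rw [subd_gp1]
  have := gp_reflect k j (X 0 + X 2 + X 2)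
  rw [show (C ((k : ℝ) - 2) * X 2 - X 0 : S) = C (k : ℝ) * X 2 - (X 0 + X 2 + X 2) by
    simp only [map_sub, map_ofNat]; ring, this]
  linear_combination (-1) ^ (k + 2 * j + 1) * (X 0 + (C (j : ℝ) + 2) * X 2) * gp_shift k j (X 0)
    + (-1) ^ (k + 2 * j + 1) * (X 0 - (C (k : ℝ) + C (j : ℝ)) * X 2) * gp_shift k j (X 0 + X 2)

/-- Homogeneous quotient. -/
lemma homog_quot (g h : S) (d e : ℕ) (hg : g.IsHomogeneous d) (hgh : (h * g).IsHomogeneous (e + d)) :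
    ∃ h' : S, h'.IsHomogeneous e ∧ h' * g = h * g := by
  refine ⟨homogeneousComponent e h, homogeneousComponent_isHomogeneous e h, ?_⟩
  have h1 := homogeneousComponent_of_mem (m := e + d) (n := e + d) hgh
  rw [if_pos rfl] at h1
  conv_rhs => rw [← h1, ← sum_homogeneousComponent h]
  rw [Finset.sum_mul, map_sum]
  have h2 : ∀ i, homogeneousComponent (e + d) (homogeneousComponent i h * g)
      = if i = e then homogeneousComponent i h * g else 0 := by
    intro i
    have := homogeneousComponent_of_mem (m := e + d) (n := i + d)
      ((homogeneousComponent_isHomogeneous i h).mul hg)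
    rw [this]
    by_cases hi : i = e
    · simp [hi]
    · rw [if_neg (by omega), if_neg hi]
  simp only [h2]
  rw [Finset.sum_ite_eq']
  split_ifs with hh
  · rfl
  · rw [homogeneousComponent_eq_zero]
    · simp
    · simp at hh
      omega

/-- Euler derivation -/
def Eul : Derivation ℝ S S := mkDerivation ℝ X

lemma Eul_X (i : Fin 3) : Eul (X i) = X i := by simp [Eul]

lemma der_apply (D : Derivation ℝ S S) (f : S) : D f = ∑ i, D (X i) * pderiv i f := by
  have : D = ∑ i, D (X i) • (pderiv i : Derivation ℝ S S) := by
    apply MvPolynomial.derivation_ext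
    intro i
    fin_cases i <;> simp [Fin.sum_univ_three, Derivation.add_apply, pderiv_X]
  conv_lhs => rw [this]
  simp [Fin.sum_univ_three, Derivation.add_apply]

lemma Eul_homog (f : S) (d : ℕ) (hf : f.IsHomogeneous d) : Eul f = d * f := by
  rw [der_apply]
  simp only [Eul_X]
  rw [hf.sum_X_mul_pderiv]
  simp

lemma der_homog (D : Derivation ℝ S S) (f : S) (d e : ℕ) (hf : f.IsHomogeneous (d + 1))
    (hD : IsHomogDer D (e + 1)) : (D f).IsHomogeneous (e + (d + 1)) := by
  rw [der_apply]
  apply IsHomogeneous.sum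
  intro i _
  have := (hD i).mul (hf.pderiv (i := i))
  convert this using 1
  omega

lemma der_dvd_mul (D : Derivation ℝ S S) (f g : S) (hf : f ∣ D f) (hg : g ∣ D g) :
    f * g ∣ D (f * g) := by
  obtain ⟨a, ha⟩ := hf
  obtain ⟨b, hb⟩ := hg
  refine ⟨a + b, ?_⟩
  rw [Derivation.leibniz, ha, hb]
  simp only [smul_eq_mul]
  ring

lemma der_dvd_prod {ι : Type*} (D : Derivation ℝ S S) (s : Finset ι) (f : ι → S)
    (h : ∀ i ∈ s, f i ∣ D (f i)) : ∏ i ∈ s, f i ∣ D (∏ i ∈ s, f i) := by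
  classical
  induction s using Finset.induction_on with
  | empty => simp
  | insert a s ha ih =>
    rw [Finset.prod_insert ha]
    exact der_dvd_mul _ _ _ (h a (by simp)) (ih fun i hi => h i (by simp [hi]))

lemma dvd_der_of_mul (D : Derivation ℝ S S) (L r : S) (hL : ∀ a b, L ∣ a * b → ¬ L ∣ a → L ∣ b)
    (hr : ¬ L ∣ r) (h : D (L * r) = 0) : L ∣ D L := by
  rw [Derivation.leibniz] at h
  simp only [smul_eq_mul] at h
  exact hL r _ ⟨-D r, by linear_combination h⟩ hr

lemma cancel_of_sub (L : S) (σ : S →ₐ[ℝ] S) (h : ∀ f, L ∣ f ↔ σ f = 0) (a b : S)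
    (hab : L ∣ a * b) (ha : ¬ L ∣ a) : L ∣ b := by
  rw [h] at hab ha ⊢
  rw [map_mul] at hab
  exact (mul_eq_zero.mp hab).resolve_left ha

lemma prod_dvd_of_sub {ι : Type*} (T : Finset ι) (F : ι → S) (σ : ι → (S →ₐ[ℝ] S))
    (h : ∀ i f, F i ∣ f ↔ σ i f = 0) (hne : ∀ i j, i ≠ j → σ i (F j) ≠ 0) (f : S)
    (hf : ∀ i ∈ T, F i ∣ f) : ∏ i ∈ T, F i ∣ f := by
  classical
  induction T using Finset.induction_on with
  | empty => simp
  | insert a s ha ih =>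
    obtain ⟨q, hq⟩ := ih fun i hi => hf i (by simp [hi])
    have h1 : F a ∣ q := by
      apply cancel_of_sub _ _ (h a) (∏ i ∈ s, F i) q
      · rw [← hq]
        exact hf a (by simp)
      · rw [h, map_prod, Finset.prod_eq_zero_iff]
        rintro ⟨i, hi, h0⟩
        exact hne a i (by rintro rfl; exact ha hi) h0
    rw [Finset.prod_insert ha, hq, mul_comm]
    exact mul_dvd_mul_left _ h1

/-- The diagonal form. -/
def Ld (c : ℝ) : S := X 0 + X 1 - C c * X 2

lemma dvdLd (c : ℝ) (f : S) : Ld c ∣ f ↔ subd c f = 0 := dvdd c f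

lemma g3_eq (k j : ℕ) : g3Poly j k =
    X 2 * Ld k * Ld ((k : ℝ) - 1) * Ld ((k : ℝ) - 2) * (gp k j (X 0) * gp k j (X 1)) := by
  unfold g3Poly Ld gp
  rw [Finset.prod_mul_distrib]

lemma g3_ne (k j : ℕ) : g3Poly j k ≠ 0 := by
  rw [g3_eq]
  have h2 : (X 2 : S) ≠ 0 := ne_zero_of_eval _ ![0, 0, 1] (by simp)
  have hd : ∀ c, Ld c ≠ 0 := fun c => ne_zero_of_eval _ ![1, 0, 0] (by simp [Ld])
  have h1 : gp k j (X 1) ≠ 0 := by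
    unfold gp
    rw [Finset.prod_ne_zero_iff]
    intro s _
    exact ne_zero_of_eval _ ![0, 1, 0] (by simp)
  simp [h2, hd, h1, gp_ne_zero]

lemma homog_lin (f : S) (a b c : ℝ) (h : f = C a * X 0 + C b * X 1 + C c * X 2) :
    f.IsHomogeneous 1 := by
  rw [h]
  exact (((isHomogeneous_X ℝ _).C_mul a).add ((isHomogeneous_X ℝ _).C_mul b)).add
    ((isHomogeneous_X ℝ _).C_mul c)

lemma Ld_homog (c : ℝ) : (Ld c).IsHomogeneous 1 :=
  homog_lin _ 1 1 (-c) (by simp [Ld]; ring)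

lemma gp_homog (k j : ℕ) (t : S) (ht : t.IsHomogeneous 1) :
    (gp k j t).IsHomogeneous (k + 2 * j + 1) := by
  rw [gp_range]
  have := IsHomogeneous.prod (Finset.range (k + 2 * j + 1))
    (fun i : ℕ => t - (C (i : ℝ) - C (j : ℝ)) * X 2) (fun _ => 1) (by
      intro i _
      rw [← map_sub]
      exact ht.sub ((isHomogeneous_X ℝ _).C_mul _))
  simpa using this

lemma g3_homog (k j : ℕ) : (g3Poly j k).IsHomogeneous (2 * (k + 2 * j + 1) + 3 + 1) := by
  rw [g3_eq]
  have := (((((isHomogeneous_X ℝ (2 : Fin 3)).mul (Ld_homog k)).mul (Ld_homog ((k : ℝ) - 1))).mul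
    (Ld_homog ((k : ℝ) - 2))).mul ((gp_homog k j _ (isHomogeneous_X ℝ (0 : Fin 3))).mul
    (gp_homog k j _ (isHomogeneous_X ℝ (1 : Fin 3)))))
  convert this using 1
  ring

lemma subd_gp1_ne (k j : ℕ) (c : ℝ) : subd c (gp k j (X 1)) ≠ 0 := by
  rw [subd_gp1, gp, Finset.prod_ne_zero_iff]
  intro s _
  exact ne_zero_of_eval _ ![1, 0, 0] (by simp)

lemma subd_Ld_ne (c c' : ℝ) (h : c ≠ c') : subd c (Ld c') ≠ 0 := by
  apply ne_zero_of_eval _ ![0, 0, 1]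
  simp [Ld, sub_eq_zero, h]

lemma log_z (k j : ℕ) (δ : Derivation ℝ S S) (h : δ (g3Poly j k) = 0) : X 2 ∣ δ (X 2) := by
  rw [g3_eq, mul_assoc, mul_assoc, mul_assoc] at h
  refine dvd_der_of_mul δ _ _ (cancel_of_sub _ _ dvd2) ?_ h
  rw [dvd2]
  simp only [map_mul, gp, map_prod, mul_eq_zero, Finset.prod_eq_zero_iff, not_or, not_exists,
    not_and]
  have hd : ∀ c, sub2 (Ld c) ≠ 0 := fun c => ne_zero_of_eval _ ![1, 0, 0] (by simp [Ld])
  refine ⟨hd _, hd _, hd _, fun s _ => ?_, fun s _ => ?_⟩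
  · exact ne_zero_of_eval _ ![1, 0, 0] (by simp)
  · exact ne_zero_of_eval _ ![0, 1, 0] (by simp)

lemma log_d_aux (k j : ℕ) (δ : Derivation ℝ S S) (a b c : ℝ) (hb : a ≠ b) (hc : a ≠ c)
    (h : δ (Ld a * (X 2 * Ld b * Ld c * (gp k j (X 0) * gp k j (X 1)))) = 0) :
    Ld a ∣ δ (Ld a) := by
  refine dvd_der_of_mul δ _ _ (cancel_of_sub _ _ (dvdLd a)) ?_ h
  rw [dvdLd]
  simp only [map_mul, mul_eq_zero, not_or, subd_gp0]
  refine ⟨⟨⟨?_, subd_Ld_ne _ _ hb⟩, subd_Ld_ne _ _ hc⟩, gp_ne_zero k j, subd_gp1_ne k j a⟩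
  exact ne_zero_of_eval _ ![0, 0, 1] (by simp)

lemma log_d0 (k j : ℕ) (δ : Derivation ℝ S S) (h : δ (g3Poly j k) = 0) :
    Ld k ∣ δ (Ld k) := by
  refine log_d_aux k j δ k (k - 1) (k - 2) (by intro h; linarith) (by intro h; linarith) ?_
  rw [← h, g3_eq]
  congr 1
  ring

lemma log_d1 (k j : ℕ) (δ : Derivation ℝ S S) (h : δ (g3Poly j k) = 0) :
    Ld ((k : ℝ) - 1) ∣ δ (Ld ((k : ℝ) - 1)) := by
  refine log_d_aux k j δ (k - 1) k (k - 2) (by simp) (by norm_num) ?_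
  rw [← h, g3_eq]
  congr 1
  ring

lemma log_d2 (k j : ℕ) (δ : Derivation ℝ S S) (h : δ (g3Poly j k) = 0) :
    Ld ((k : ℝ) - 2) ∣ δ (Ld ((k : ℝ) - 2)) := by
  refine log_d_aux k j δ (k - 2) k (k - 1) (by simp) (by norm_num) ?_
  rw [← h, g3_eq]
  congr 1
  ring

lemma log_x (k j : ℕ) (δ : Derivation ℝ S S) (h : δ (g3Poly j k) = 0) (s : ℤ)
    (hs : s ∈ Finset.Icc (-(j : ℤ)) ((k : ℤ) + j)) :
    X 0 - C (s : ℝ) * X 2 ∣ δ (X 0 - C (s : ℝ) * X 2) := by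
  have e : g3Poly j k = (X 0 - C (s : ℝ) * X 2) *
      ((∏ t ∈ (Finset.Icc (-(j : ℤ)) ((k : ℤ) + j)).erase s, (X 0 - C (t : ℝ) * X 2)) *
      (X 2 * Ld k * Ld ((k : ℝ) - 1) * Ld ((k : ℝ) - 2) * gp k j (X 1))) := by
    rw [g3_eq, ← mul_assoc (X 0 - C (s : ℝ) * X 2), Finset.mul_prod_erase _ (fun t : ℤ => (X 0 - C (t : ℝ) * X 2 : S)) hs,
      gp]
    ring
  rw [e] at h
  refine dvd_der_of_mul δ _ _ (cancel_of_sub _ _ (dvd0 s)) ?_ h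
  rw [dvd0]
  simp only [map_mul, gp, map_prod, mul_eq_zero, Finset.prod_eq_zero_iff, not_or, not_exists,
    not_and]
  have hd : ∀ c, sub0 s (Ld c) ≠ 0 := fun c => ne_zero_of_eval _ ![0, 1, 0] (by simp [Ld])
  refine ⟨fun t ht => ?_, ⟨⟨⟨?_, hd _⟩, hd _⟩, hd _⟩, fun t _ => ?_⟩
  · apply ne_zero_of_eval _ ![0, 0, 1]
    have : s ≠ t := fun h => (Finset.mem_erase.mp ht).1 h.symm
    simpa [sub_eq_zero] using this
  · exact ne_zero_of_eval _ ![0, 0, 1] (by simp)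
  · exact ne_zero_of_eval _ ![0, 1, 0] (by simp)

lemma log_y (k j : ℕ) (δ : Derivation ℝ S S) (h : δ (g3Poly j k) = 0) (s : ℤ)
    (hs : s ∈ Finset.Icc (-(j : ℤ)) ((k : ℤ) + j)) :
    X 1 - C (s : ℝ) * X 2 ∣ δ (X 1 - C (s : ℝ) * X 2) := by
  have e : g3Poly j k = (X 1 - C (s : ℝ) * X 2) *
      ((∏ t ∈ (Finset.Icc (-(j : ℤ)) ((k : ℤ) + j)).erase s, (X 1 - C (t : ℝ) * X 2)) *
      (X 2 * Ld k * Ld ((k : ℝ) - 1) * Ld ((k : ℝ) - 2) * gp k j (X 0))) := by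
    rw [g3_eq, ← mul_assoc (X 1 - C (s : ℝ) * X 2), Finset.mul_prod_erase _ (fun t : ℤ => (X 1 - C (t : ℝ) * X 2 : S)) hs]
    rw [show gp k j (X 1) = ∏ s ∈ Finset.Icc (-(j : ℤ)) ((k : ℤ) + j), (X 1 - C (s : ℝ) * X 2)
      from rfl]
    ring
  rw [e] at h
  refine dvd_der_of_mul δ _ _ (cancel_of_sub _ _ (dvd1 s)) ?_ h
  rw [dvd1]
  simp only [map_mul, gp, map_prod, mul_eq_zero, Finset.prod_eq_zero_iff, not_or, not_exists,
    not_and]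
  have hd : ∀ c, sub1 s (Ld c) ≠ 0 := fun c => ne_zero_of_eval _ ![1, 0, 0] (by simp [Ld])
  refine ⟨fun t ht => ?_, ⟨⟨⟨?_, hd _⟩, hd _⟩, hd _⟩, fun t _ => ?_⟩
  · apply ne_zero_of_eval _ ![0, 0, 1]
    have : s ≠ t := fun h => (Finset.mem_erase.mp ht).1 h.symm
    simpa [sub_eq_zero] using this
  · exact ne_zero_of_eval _ ![0, 0, 1] (by simp)
  · exact ne_zero_of_eval _ ![1, 0, 0] (by simp)

lemma gp0_dvd (k j : ℕ) (f : S)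
    (h : ∀ s ∈ Finset.Icc (-(j : ℤ)) ((k : ℤ) + j), (X 0 - C (s : ℝ) * X 2 : S) ∣ f) :
    gp k j (X 0) ∣ f := by
  refine prod_dvd_of_sub _ (fun s : ℤ => (X 0 - C (s : ℝ) * X 2 : S)) (fun s => sub0 s)
    (fun s f => dvd0 s f) ?_ f h
  intro s t hst
  apply ne_zero_of_eval _ ![0, 0, 1]
  simpa [sub_eq_zero] using hst

lemma gp1_dvd (k j : ℕ) (f : S)
    (h : ∀ s ∈ Finset.Icc (-(j : ℤ)) ((k : ℤ) + j), (X 1 - C (s : ℝ) * X 2 : S) ∣ f) :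
    gp k j (X 1) ∣ f := by
  refine prod_dvd_of_sub _ (fun s : ℤ => (X 1 - C (s : ℝ) * X 2 : S)) (fun s => sub1 s)
    (fun s f => dvd1 s f) ?_ f h
  intro s t hst
  apply ne_zero_of_eval _ ![0, 0, 1]
  simpa [sub_eq_zero] using hst

def eps (k j : ℕ) : S := (-1) ^ (k + 2 * j + 1)

lemma eps_sq (k j : ℕ) : eps k j * eps k j = 1 := by
  unfold eps
  rw [← mul_pow]
  simp

def Up (k j : ℕ) : S := X 0 - (C (k : ℝ) + C (j : ℝ)) * X 2
def Vp (k j : ℕ) : S := X 1 - (C (k : ℝ) + C (j : ℝ)) * X 2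

lemma Up_ne (k j : ℕ) (c : ℝ) : subd c (Up k j) ≠ 0 :=
  ne_zero_of_eval _ ![1, 0, 0] (by simp [Up])

lemma Upz_ne (k j : ℕ) (c : ℝ) : subd c (Up k j + X 2) ≠ 0 :=
  ne_zero_of_eval _ ![1, 0, 0] (by simp [Up])

lemma subd_eps (k j : ℕ) (c : ℝ) : subd c (eps k j) = eps k j := by
  simp [eps]

lemma cond0 (k j : ℕ) (A B : S) :
    Ld k ∣ gp k j (X 0) * A + (-(eps k j) * gp k j (X 1)) * B ↔ Ld k ∣ A - B := by
  rw [dvdLd, dvdLd]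
  have h : subd k (gp k j (X 0) * A + (-(eps k j) * gp k j (X 1)) * B)
      = gp k j (X 0) * subd k (A - B) := by
    simp only [map_add, map_mul, map_neg, map_sub, subd_gp0, subd_eps]
    have := gpd0 k j
    rw [← eps] at this
    rw [this]
    linear_combination (- gp k j (X 0) * subd k B) * eps_sq k j
  rw [h, mul_eq_zero, or_iff_right (gp_ne_zero k j)]

lemma cond1 (k j : ℕ) (A B : S) :
    Ld ((k : ℝ) - 1) ∣ gp k j (X 0) * A + (-(eps k j) * gp k j (X 1)) * B ↔
      Ld ((k : ℝ) - 1) ∣ Up k j * A + Vp k j * B := by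
  rw [dvdLd, dvdLd]
  have h : subd ((k : ℝ) - 1) (Up k j) *
      subd ((k : ℝ) - 1) (gp k j (X 0) * A + (-(eps k j) * gp k j (X 1)) * B)
      = gp k j (X 0) * subd ((k : ℝ) - 1) (Up k j * A + Vp k j * B) := by
    have := gpd1 k j
    rw [← eps] at this
    simp only [map_add, map_mul, map_neg, map_sub, subd_gp0, subd_eps, Up, Vp, subd_0, subd_1,
      subd_2, subd_C, map_one]
    linear_combination (- (X 0 + (C (j : ℝ) + 1) * X 2) * gp k j (X 0)
      * subd ((k : ℝ) - 1) B) * eps_sq k j - eps k j * subd ((k : ℝ) - 1) B * this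
  constructor
  · intro h0
    rw [h0, mul_zero, eq_comm, mul_eq_zero] at h
    exact h.resolve_left (gp_ne_zero k j)
  · intro h0
    rw [h0, mul_zero, mul_eq_zero] at h
    exact h.resolve_left (Up_ne k j _)

lemma cond2 (k j : ℕ) (A B : S) :
    Ld ((k : ℝ) - 2) ∣ gp k j (X 0) * A + (-(eps k j) * gp k j (X 1)) * B ↔
      Ld ((k : ℝ) - 2) ∣ Up k j * (Up k j + X 2) * A - Vp k j * (Vp k j + X 2) * B := by
  rw [dvdLd, dvdLd]
  have h : subd ((k : ℝ) - 2) (Up k j) * subd ((k : ℝ) - 2) (Up k j + X 2) *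
      subd ((k : ℝ) - 2) (gp k j (X 0) * A + (-(eps k j) * gp k j (X 1)) * B)
      = gp k j (X 0) * subd ((k : ℝ) - 2)
        (Up k j * (Up k j + X 2) * A - Vp k j * (Vp k j + X 2) * B) := by
    have := gpd2 k j
    rw [← eps] at this
    simp only [map_add, map_mul, map_neg, map_sub, subd_gp0, subd_eps, Up, Vp, subd_0, subd_1,
      subd_2, subd_C, map_ofNat]
    linear_combination (- (X 0 + (C (j : ℝ) + 1) * X 2) * (X 0 + (C (j : ℝ) + 2) * X 2)
      * gp k j (X 0) * subd ((k : ℝ) - 2) B) * eps_sq k j - eps k j * subd ((k : ℝ) - 2) B * this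
  constructor
  · intro h0
    rw [h0, mul_zero, eq_comm, mul_eq_zero] at h
    exact h.resolve_left (gp_ne_zero k j)
  · intro h0
    rw [h0, mul_zero, mul_eq_zero] at h
    exact h.resolve_left (mul_ne_zero (Up_ne k j _) (Upz_ne k j _))

/-- `p = k + 2j + 1` as a constant polynomial. -/
def pp (k j : ℕ) : S := C (k : ℝ) + 2 * C (j : ℝ) + 1

lemma pp_eq (k j : ℕ) : pp k j = C ((k : ℝ) + 2 * j + 1) := by
  simp only [pp, map_add, map_mul, map_one, map_ofNat]

lemma pp_inv (k j : ℕ) : ∃ q : S, q * pp k j = 1 := by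
  refine ⟨C ((k : ℝ) + 2 * j + 1)⁻¹, ?_⟩
  rw [pp_eq, ← C_mul, inv_mul_cancel₀ (by positivity), C_1]

lemma pp1_inv (k j : ℕ) (h : 2 ≤ k + j) : ∃ q : S, q * (pp k j - 1) = 1 := by
  have h0 : (0 : ℝ) < k + 2 * j := by
    have : 0 < k + 2 * j := by omega
    exact_mod_cast this
  refine ⟨C ((k : ℝ) + 2 * j)⁻¹, ?_⟩
  rw [pp_eq, ← C_1, ← C_sub, ← C_mul, add_sub_cancel_right, inv_mul_cancel₀ h0.ne']

def CC (k : ℕ) (c : Fin 3 → S) : S := (X 0 - X 1) * c 0 + Ld ((k : ℝ) - 2) * c 1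
def DD (k j : ℕ) (c : Fin 3 → S) : S :=
  -(pp k j - 1) * Up k j * c 0 + Ld ((k : ℝ) - 2) * c 2
def fB (k j : ℕ) (c : Fin 3 → S) : S := -Up k j * CC k c + Ld ((k : ℝ) - 1) * DD k j c
def fA (k j : ℕ) (c : Fin 3 → S) : S := fB k j c + pp k j * Ld k * CC k c

lemma gen0 (k j : ℕ) (c : Fin 3 → S) : Ld k ∣ fA k j c - fB k j c :=
  ⟨pp k j * CC k c, by unfold fA; ring⟩

lemma gen1 (k j : ℕ) (c : Fin 3 → S) :
    Ld ((k : ℝ) - 1) ∣ Up k j * fA k j c + Vp k j * fB k j c := by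
  refine ⟨fB k j c + pp k j * Up k j * CC k c - pp k j * X 2 * DD k j c, ?_⟩
  unfold fA fB
  generalize CC k c = c1
  generalize DD k j c = d1
  simp only [Ld, Up, Vp, pp, map_sub, map_one]
  ring

lemma gen2 (k j : ℕ) (c : Fin 3 → S) :
    Ld ((k : ℝ) - 2) ∣ Up k j * (Up k j + X 2) * fA k j c - Vp k j * (Vp k j + X 2) * fB k j c := by
  refine ⟨(X 0 - X 1) * fB k j c + pp k j * Up k j * (Up k j + X 2) * CC k c
    - pp k j * X 2 * (Up k j * CC k c + (X 0 - X 1) * DD k j c)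
    + pp k j * X 2 ^ 2 * ((pp k j - 1) * Up k j * c 1 + (X 0 - X 1) * c 2), ?_⟩
  unfold fA fB CC DD
  simp only [Ld, Up, Vp, pp, map_sub, map_one, map_ofNat]
  ring

lemma gen_surj (k j : ℕ) (hkj : 2 ≤ k + j) (A B : S) (h0 : Ld k ∣ A - B)
    (h1 : Ld ((k : ℝ) - 1) ∣ Up k j * A + Vp k j * B)
    (h2 : Ld ((k : ℝ) - 2) ∣ Up k j * (Up k j + X 2) * A - Vp k j * (Vp k j + X 2) * B) :
    ∃ c, A = fA k j c ∧ B = fB k j c := by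
  obtain ⟨q, hq⟩ := pp_inv k j
  obtain ⟨q1, hq1⟩ := pp1_inv k j hkj
  have hz : ∀ c, subd c (X 2) ≠ 0 := fun c => ne_zero_of_eval _ ![0, 0, 1] (by simp)
  have e1 : Ld k = Ld ((k : ℝ) - 1) - X 2 := by simp only [Ld, map_sub, map_one, map_ofNat]; ring
  have e2 : Ld k = Ld ((k : ℝ) - 2) - 2 * X 2 := by simp only [Ld, map_sub, map_one, map_ofNat]; ring
  have e12 : Ld ((k : ℝ) - 1) = Ld ((k : ℝ) - 2) - X 2 := by simp only [Ld, map_sub, map_one, map_ofNat]; ring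
  have e3 : Up k j + Vp k j = Ld ((k : ℝ) - 1) - pp k j * X 2 := by
    simp only [Ld, Up, Vp, pp, map_sub, map_one, map_ofNat]; ring
  have e4 : Up k j + Vp k j = Ld ((k : ℝ) - 2) - X 2 - pp k j * X 2 := by
    simp only [Ld, Up, Vp, pp, map_sub, map_one, map_ofNat]; ring
  have e5 : Up k j - Vp k j = X 0 - X 1 := by simp [Up, Vp]
  obtain ⟨C0, hC0⟩ := h0
  obtain ⟨C1, hC1⟩ : ∃ C1, C0 = pp k j * C1 := ⟨q * C0, by linear_combination (-C0) * hq⟩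
  subst hC1
  obtain rfl : A = B + Ld k * (pp k j * C1) := by linear_combination hC0
  have h1' : Ld ((k : ℝ) - 1) ∣ X 2 * (B + Up k j * C1) := by
    obtain ⟨w, hw⟩ := h1
    refine ⟨q * (B + pp k j * Up k j * C1 - w), ?_⟩
    rw [e1] at hw
    linear_combination (-q) * hw + q * B * e3 - (X 2 * (B + Up k j * C1)) * hq
  have h1'' : Ld ((k : ℝ) - 1) ∣ B + Up k j * C1 := by
    refine cancel_of_sub _ _ (dvdLd _) _ _ h1' ?_
    rw [dvdLd]
    exact hz _
  obtain ⟨D1, hD1⟩ := h1''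
  obtain rfl : B = -Up k j * C1 + Ld ((k : ℝ) - 1) * D1 := by linear_combination hD1
  have h2' : Ld ((k : ℝ) - 2) ∣ X 2 ^ 2 * ((pp k j - 1) * Up k j * C1 + (X 0 - X 1) * D1) := by
    obtain ⟨w, hw⟩ := h2
    refine ⟨q * (w - ((X 0 - X 1) * (-Up k j * C1 + Ld ((k : ℝ) - 1) * D1)
      + pp k j * Up k j * (Up k j + X 2) * C1
      - pp k j * X 2 * (Up k j * C1 + (X 0 - X 1) * D1))), ?_⟩
    have key : pp k j * (X 2 ^ 2 * ((pp k j - 1) * Up k j * C1 + (X 0 - X 1) * D1)) =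
      Ld ((k : ℝ) - 2) * (w - ((X 0 - X 1) * (-Up k j * C1 + Ld ((k : ℝ) - 1) * D1)
      + pp k j * Up k j * (Up k j + X 2) * C1
      - pp k j * X 2 * (Up k j * C1 + (X 0 - X 1) * D1))) := by
      have : pp k j * (X 2 ^ 2 * ((pp k j - 1) * Up k j * C1 + (X 0 - X 1) * D1)) =
        Up k j * (Up k j + X 2) * (-Up k j * C1 + Ld ((k : ℝ) - 1) * D1
          + Ld k * (pp k j * C1)) - Vp k j * (Vp k j + X 2) *
          (-Up k j * C1 + Ld ((k : ℝ) - 1) * D1) -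
        Ld ((k : ℝ) - 2) * (((X 0 - X 1) * (-Up k j * C1 + Ld ((k : ℝ) - 1) * D1)
        + pp k j * Up k j * (Up k j + X 2) * C1
        - pp k j * X 2 * (Up k j * C1 + (X 0 - X 1) * D1))) := by
        simp only [Ld, Up, Vp, pp, map_sub, map_one, map_ofNat]
        ring
      linear_combination this + hw
    linear_combination q * key
      - (X 2 ^ 2 * ((pp k j - 1) * Up k j * C1 + (X 0 - X 1) * D1)) * hq
  have h2'' : Ld ((k : ℝ) - 2) ∣ (pp k j - 1) * Up k j * C1 + (X 0 - X 1) * D1 := by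
    refine cancel_of_sub _ _ (dvdLd _) _ _ h2' ?_
    rw [dvdLd, map_pow]
    exact pow_ne_zero _ (hz _)
  rw [dvdLd] at h2''
  have hU : subd ((k : ℝ) - 2) (Up k j) = Up k j := by simp [Up]
  have hp : subd ((k : ℝ) - 2) (pp k j) = pp k j := by rw [pp_eq, subd_C]
  simp only [map_add, map_mul, map_sub, map_one, hU, hp] at h2''
  have hUeq : Up k j = X 0 - C ((k : ℝ) + j) * X 2 := by simp [Up]
  have hUd : Up k j ∣ subd ((k : ℝ) - 2) D1 := by
    rw [hUeq]
    refine cancel_of_sub _ _ (dvd0 _) (subd ((k : ℝ) - 2) (X 0) - subd ((k : ℝ) - 2) (X 1)) _ ?_ ?_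
    · rw [← hUeq]
      exact ⟨-(pp k j - 1) * subd ((k : ℝ) - 2) C1, by linear_combination h2''⟩
    · rw [dvd0]
      apply ne_zero_of_eval _ ![0, 0, 1]
      simp
      have : (0 : ℝ) ≤ k := by positivity
      have : (0 : ℝ) ≤ j := by positivity
      intro h
      linarith
  obtain ⟨w, hw⟩ := hUd
  have hU0 : Up k j ≠ 0 := ne_zero_of_eval _ ![1, 0, 0] (by simp [Up])
  have hw' : subd ((k : ℝ) - 2) C1 =
      (subd ((k : ℝ) - 2) (X 0) - subd ((k : ℝ) - 2) (X 1)) * (-q1 * w) := by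
    apply mul_left_cancel₀ hU0
    rw [hw] at h2''
    linear_combination q1 * h2'' - Up k j * subd ((k : ℝ) - 2) C1 * hq1
  -- the substitution is idempotent
  have idem : ∀ f, subd ((k : ℝ) - 2) (subd ((k : ℝ) - 2) f) = subd ((k : ℝ) - 2) f := by
    have : (subd ((k : ℝ) - 2)).comp (subd ((k : ℝ) - 2)) = subd ((k : ℝ) - 2) := by
      apply MvPolynomial.algHom_ext
      intro i
      fin_cases i <;> simp
    intro f
    exact DFunLike.congr_fun this f
  have hwi : subd ((k : ℝ) - 2) w = w := by
    apply mul_left_cancel₀ hU0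
    have := congrArg (subd ((k : ℝ) - 2)) hw
    rw [idem, map_mul, hU, hw] at this
    exact this.symm
  have hqi : subd ((k : ℝ) - 2) q1 = q1 := by
    have := congrArg (subd ((k : ℝ) - 2)) hq1
    rw [map_mul, map_sub, map_one, hp] at this
    linear_combination q1 * this - subd ((k : ℝ) - 2) q1 * hq1
  have d1 : Ld ((k : ℝ) - 2) ∣ C1 - (X 0 - X 1) * (-q1 * w) := by
    rw [dvdLd]
    simp only [map_mul, map_sub, map_neg, hwi, hqi, hw']
    ring
  have d2 : Ld ((k : ℝ) - 2) ∣ D1 - (-(pp k j - 1) * Up k j * (-q1 * w)) := by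
    rw [dvdLd]
    simp only [map_mul, map_sub, map_neg, map_one, hwi, hqi, hw, hU, hp]
    linear_combination (-Up k j * w) * hq1
  obtain ⟨r1, hr1⟩ := d1
  obtain ⟨r2, hr2⟩ := d2
  have f1 : CC k ![-q1 * w, r1, r2] = C1 := by
    simp [CC]
    linear_combination -hr1
  have f2 : DD k j ![-q1 * w, r1, r2] = D1 := by
    simp [DD]
    linear_combination -hr2
  refine ⟨![-q1 * w, r1, r2], ?_, ?_⟩
  · rw [fA, fB, f1, f2]
    ring
  · rw [fB, f1, f2]

/-- The logarithmic derivation with `z`-component zero attached to the coefficients `c`. -/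
def Phi (k j : ℕ) (c : Fin 3 → S) : Derivation ℝ S S :=
  mkDerivation ℝ ![gp k j (X 0) * fA k j c, -(eps k j) * gp k j (X 1) * fB k j c, 0]

lemma Phi_0 (k j : ℕ) (c : Fin 3 → S) : Phi k j c (X 0) = gp k j (X 0) * fA k j c := by
  simp [Phi]
lemma Phi_1 (k j : ℕ) (c : Fin 3 → S) :
    Phi k j c (X 1) = -(eps k j) * gp k j (X 1) * fB k j c := by
  simp [Phi]
lemma Phi_2 (k j : ℕ) (c : Fin 3 → S) : Phi k j c (X 2) = 0 := by
  simp [Phi]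

lemma der_C_mul (D : Derivation ℝ S S) (a : ℝ) (f : S) : D (C a * f) = C a * D f := by
  rw [← smul_eq_C_mul, ← smul_eq_C_mul, D.map_smul]

lemma der_Ld (D : Derivation ℝ S S) (a : ℝ) :
    D (Ld a) = D (X 0) + D (X 1) - C a * D (X 2) := by
  rw [Ld, map_sub, map_add, der_C_mul]

lemma Phi_log (k j : ℕ) (c : Fin 3 → S) : g3Poly j k ∣ Phi k j c (g3Poly j k) := by
  have hd : ∀ a : ℝ, Phi k j c (Ld a) =
      gp k j (X 0) * fA k j c + -(eps k j) * gp k j (X 1) * fB k j c := by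
    intro a
    rw [der_Ld, Phi_0, Phi_1, Phi_2]
    ring
  rw [g3_eq]
  refine der_dvd_mul _ _ _ (der_dvd_mul _ _ _ (der_dvd_mul _ _ _ (der_dvd_mul _ _ _ ?_ ?_) ?_) ?_)
    (der_dvd_mul _ _ _ (der_dvd_prod _ _ _ ?_) (der_dvd_prod _ _ _ ?_))
  · simp [Phi_2]
  · rw [hd, cond0]
    exact gen0 k j c
  · rw [hd, cond1]
    exact gen1 k j c
  · rw [hd, cond2]
    exact gen2 k j c
  · intro s hs
    rw [map_sub, der_C_mul, Phi_0, Phi_2, mul_zero, sub_zero, gp]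
    exact (Finset.dvd_prod_of_mem _ hs).mul_right _
  · intro s hs
    rw [map_sub, der_C_mul, Phi_1, Phi_2, mul_zero, sub_zero, gp]
    exact ((Finset.dvd_prod_of_mem _ hs).mul_left _).mul_right _

/-- The basis coefficient vectors. -/
def ee (i : Fin 3) : Fin 3 → S := Pi.single i 1

lemma Phi_sum (k j : ℕ) (c : Fin 3 → S) : ∑ i, c i • Phi k j (ee i) = Phi k j c := by
  apply MvPolynomial.derivation_ext
  intro i
  fin_cases i
  · simp [Fin.sum_univ_three, Derivation.add_apply, Phi_0, fA, fB, CC, DD, ee]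
    ring
  · simp [Fin.sum_univ_three, Derivation.add_apply, Phi_1, fB, CC, DD, ee]
    ring
  · simp [Fin.sum_univ_three, Derivation.add_apply, Phi_2]

def ell (k j : ℕ) : Fin 3 → S :=
  ![Ld ((k : ℝ) - 2), -(X 0 - X 1), (pp k j - 1) * Up k j]

lemma gp1_ne_zero (k j : ℕ) : gp k j (X 1) ≠ 0 := by
  intro h
  have := subd_gp1_ne k j 0
  rw [h] at this
  simp at this

lemma Ld_ne (a : ℝ) : Ld a ≠ 0 := ne_zero_of_eval _ ![1, 0, 0] (by simp [Ld])

lemma Phi_eq_zero (k j : ℕ) (c : Fin 3 → S) :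
    Phi k j c = 0 ↔ ∃ v : S, (fun i => ell k j i * v) = c := by
  constructor
  · intro h
    have h0 := Phi_0 k j c
    have h1 := Phi_1 k j c
    rw [h] at h0 h1
    have hA : fA k j c = 0 := by
      have := h0.symm
      simpa [gp_ne_zero] using this
    have hB : fB k j c = 0 := by
      have he : eps k j ≠ 0 := by
        intro h
        have := eps_sq k j
        rw [h] at this
        simp at this
      have := h1.symm
      simpa [gp1_ne_zero, he] using this
    have hC : CC k c = 0 := by
      obtain ⟨q, hq⟩ := pp_inv k j
      rw [fA, hB, zero_add] at hA
      apply mul_left_cancel₀ (Ld_ne k)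
      linear_combination q * hA - Ld k * CC k c * hq
    have hD : DD k j c = 0 := by
      rw [fB, hC, mul_zero, zero_add] at hB
      exact (mul_eq_zero.mp hB).resolve_left (Ld_ne _)
    rw [CC] at hC
    rw [DD] at hD
    have hd : Ld ((k : ℝ) - 2) ∣ c 0 := by
      refine cancel_of_sub _ _ (dvdLd _) (X 0 - X 1) _ ⟨-c 1, by linear_combination hC⟩ ?_
      rw [dvdLd]
      exact ne_zero_of_eval _ ![1, 0, 0] (by simp)
    obtain ⟨v, hv⟩ := hd
    refine ⟨v, ?_⟩
    funext i
    fin_cases i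
    · simp [ell, hv]
    · apply mul_left_cancel₀ (Ld_ne ((k : ℝ) - 2))
      change Ld ((k : ℝ) - 2) * (-(X 0 - X 1) * v) = Ld ((k : ℝ) - 2) * c 1
      linear_combination (X 0 - X 1) * hv - hC
    · apply mul_left_cancel₀ (Ld_ne ((k : ℝ) - 2))
      change Ld ((k : ℝ) - 2) * ((pp k j - 1) * Up k j * v) = Ld ((k : ℝ) - 2) * c 2
      linear_combination (-(pp k j - 1) * Up k j) * hv - hD
  · rintro ⟨v, rfl⟩
    have hC : CC k (fun i => ell k j i * v) = 0 := by
      simp [CC, ell]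
      ring
    have hD : DD k j (fun i => ell k j i * v) = 0 := by
      simp [DD, ell]
      ring
    have hB : fB k j (fun i => ell k j i * v) = 0 := by simp [fB, hC, hD]
    have hA : fA k j (fun i => ell k j i * v) = 0 := by simp [fA, hB, hC]
    apply MvPolynomial.derivation_ext
    intro i
    fin_cases i
    · simp [Phi_0, hA]
    · simp [Phi_1, hB]
    · simp [Phi_2]

lemma Up_homog (k j : ℕ) : (Up k j).IsHomogeneous 1 :=
  homog_lin _ 1 0 (-((k : ℝ) + j)) (by simp [Up]; ring)

lemma sub_homog : (X 0 - X 1 : S).IsHomogeneous 1 :=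
  homog_lin _ 1 (-1) 0 (by simp; ring)

lemma ppU_homog (k j : ℕ) : ((pp k j - 1) * Up k j).IsHomogeneous 1 := by
  rw [pp_eq, ← C_1, ← C_sub]
  exact (Up_homog k j).C_mul _

lemma ell_homog (k j : ℕ) (i : Fin 3) : (ell k j i).IsHomogeneous 1 := by
  fin_cases i
  · exact Ld_homog _
  · exact sub_homog.neg
  · exact ppU_homog k j

lemma CC_homog (k : ℕ) (i : Fin 3) : (CC k (ee i)).IsHomogeneous 1 := by
  fin_cases i
  · simpa [CC, ee] using sub_homog
  · simpa [CC, ee] using Ld_homog _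
  · simpa [CC, ee] using isHomogeneous_zero (Fin 3) ℝ 1

lemma DD_homog (k j : ℕ) (i : Fin 3) : (DD k j (ee i)).IsHomogeneous 1 := by
  fin_cases i
  · have := (ppU_homog k j).neg
    rw [← neg_mul] at this
    simpa [DD, ee] using this
  · simpa [DD, ee] using isHomogeneous_zero (Fin 3) ℝ 1
  · simpa [DD, ee] using Ld_homog _

lemma fB_homog (k j : ℕ) (i : Fin 3) : (fB k j (ee i)).IsHomogeneous 2 :=
  ((Up_homog k j).neg.mul (CC_homog k i)).add ((Ld_homog _).mul (DD_homog k j i))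

lemma fA_homog (k j : ℕ) (i : Fin 3) : (fA k j (ee i)).IsHomogeneous 2 := by
  refine (fB_homog k j i).add ?_
  rw [pp_eq]
  exact ((Ld_homog _).C_mul _).mul (CC_homog k i)

lemma Phi_homog (k j : ℕ) (i : Fin 3) : IsHomogDer (Phi k j (ee i)) (k + 2 * j + 3) := by
  intro m
  fin_cases m
  · have := (gp_homog k j _ (isHomogeneous_X ℝ (0 : Fin 3))).mul (fA_homog k j i)
    simpa [Phi_0] using this
  · have := ((gp_homog k j _ (isHomogeneous_X ℝ (1 : Fin 3))).C_mul
      (-(-1) ^ (k + 2 * j + 1))).mul (fB_homog k j i)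
    simpa [Phi_1, eps] using this
  · simpa [Phi_2] using isHomogeneous_zero (Fin 3) ℝ (k + 2 * j + 3)

lemma ell_indep (k j : ℕ) (hkj : 2 ≤ k + j) : LinearIndependent ℝ (ell k j) := by
  rw [Fintype.linearIndependent_iff]
  intro g hg
  have h0 : (0 : ℝ) < k + 2 * j := by
    have : 0 < k + 2 * j := by omega
    exact_mod_cast this
  have e1 := congrArg (eval ![1, 0, 0]) hg
  have e2 := congrArg (eval ![0, 1, 0]) hg
  have e3 := congrArg (eval ![0, 0, 1]) hg
  simp only [Fin.sum_univ_three, ell, pp_eq, Ld, Up, smul_eq_C_mul] at e1 e2 e3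
  simp at e1 e2 e3
  have g0 : g 0 * (k + 2 * j + 2) = 0 := by
    linear_combination e3 + (k + j) * e1 + (k + j) * e2
  have g0' : g 0 = 0 := (mul_eq_zero.mp g0).resolve_right (by linarith)
  have g1 : g 1 = 0 := by linear_combination e2 - g0'
  have g2 : g 2 * (k + 2 * j) = 0 := by linear_combination e1 - g0' + g1
  have g2' : g 2 = 0 := (mul_eq_zero.mp g2).resolve_right h0.ne'
  intro i
  fin_cases i
  · exact g0'
  · exact g1
  · exact g2'

lemma exists_Phi (k j : ℕ) (hkj : 2 ≤ k + j) (δ : Derivation ℝ S S) (h : δ (g3Poly j k) = 0) :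
    ∃ (q : S) (c : Fin 3 → S), δ = Phi k j c + q • Eul := by
  obtain ⟨q, hq⟩ := log_z k j δ h
  have hx : ∀ s ∈ Finset.Icc (-(j : ℤ)) ((k : ℤ) + j),
      (X 0 - C (s : ℝ) * X 2 : S) ∣ δ (X 0) - q * X 0 := by
    intro s hs
    obtain ⟨w, hw⟩ := log_x k j δ h s hs
    rw [map_sub, der_C_mul, hq] at hw
    exact ⟨w - q, by linear_combination hw⟩
  have hy : ∀ s ∈ Finset.Icc (-(j : ℤ)) ((k : ℤ) + j),
      (X 1 - C (s : ℝ) * X 2 : S) ∣ δ (X 1) - q * X 1 := by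
    intro s hs
    obtain ⟨w, hw⟩ := log_y k j δ h s hs
    rw [map_sub, der_C_mul, hq] at hw
    exact ⟨w - q, by linear_combination hw⟩
  obtain ⟨A, hA⟩ := gp0_dvd k j _ hx
  obtain ⟨B0, hB0⟩ := gp1_dvd k j _ hy
  have hB : δ (X 1) - q * X 1 = (-(eps k j) * gp k j (X 1)) * (-(eps k j) * B0) := by
    linear_combination hB0 - gp k j (X 1) * B0 * eps_sq k j
  generalize -(eps k j) * B0 = B at hB
  have hd : ∀ a : ℝ, Ld a ∣ δ (Ld a) →
      Ld a ∣ gp k j (X 0) * A + (-(eps k j) * gp k j (X 1)) * B := by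
    intro a ha
    rw [← hA, ← hB]
    obtain ⟨w, hw⟩ := ha
    rw [der_Ld, hq] at hw
    refine ⟨w - q, ?_⟩
    rw [mul_sub, ← hw, Ld]
    ring
  have c0 := (cond0 k j A B).mp (hd _ (log_d0 k j δ h))
  have c1 := (cond1 k j A B).mp (hd _ (log_d1 k j δ h))
  have c2 := (cond2 k j A B).mp (hd _ (log_d2 k j δ h))
  obtain ⟨c, rfl, rfl⟩ := gen_surj k j hkj A B c0 c1 c2
  refine ⟨q, c, ?_⟩
  apply MvPolynomial.derivation_ext
  intro i
  fin_cases i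
  · simp [Derivation.add_apply, Phi_0, Eul_X]
    linear_combination hA
  · simp [Derivation.add_apply, Phi_1, Eul_X]
    linear_combination hB
  · simp [Derivation.add_apply, Phi_2, Eul_X]
    linear_combination hq

lemma exists_h (k j : ℕ) (i : Fin 3) : ∃ h : S, h.IsHomogeneous (k + 2 * j + 2) ∧
    Phi k j (ee i) (g3Poly j k) = h * g3Poly j k := by
  obtain ⟨h, hh⟩ := Phi_log k j (ee i)
  have h1 := der_homog (Phi k j (ee i)) _ _ (k + 2 * j + 2) (g3_homog k j) (Phi_homog k j i)
  rw [hh, mul_comm] at h1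
  obtain ⟨h', h2, h3⟩ := homog_quot _ _ _ _ (g3_homog k j) h1
  exact ⟨h', h2, by rw [hh, h3, mul_comm]⟩

lemma Eul_D0 (k j : ℕ) (r : S) (h : (r • Eul) (g3Poly j k) = 0) : r = 0 := by
  rw [Derivation.smul_apply, Eul_homog _ _ (g3_homog k j), smul_eq_mul] at h
  rcases mul_eq_zero.mp h with h | h
  · exact h
  · rcases mul_eq_zero.mp h with h | h
    · exact absurd h (Nat.cast_ne_zero.mpr (Nat.succ_ne_zero _))
    · exact absurd h (g3_ne k j)

/-- `F_3 = T_{A_3}(k+2j+3) ≃ T_{ℙ²}(-1)`: there is an exact sequence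
`0 → S → S³ → D_0(g_3) → 0` given by three independent linear forms and three
derivations homogeneous of degree `k+2j+3`. -/
theorem grid_plus_three_diagonals (k j : ℕ) (hkj : 2 ≤ k + j) :
    ∃ (ℓ : Fin 3 → S) (θ : Fin 3 → Derivation ℝ S S),
      (∀ i, (ℓ i).IsHomogeneous 1) ∧ LinearIndependent ℝ ℓ ∧
      (∀ i, θ i ∈ D0 (g3Poly j k)) ∧
      (∀ i, IsHomogDer (θ i) (k + 2 * j + 3)) ∧
      Function.Injective (fun v : S => fun i => ℓ i * v) ∧
      (∀ a : Fin 3 → S, (∑ i, a i • θ i) = 0 ↔ ∃ v : S, (fun i => ℓ i * v) = a) ∧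
      (∀ δ ∈ D0 (g3Poly j k), ∃ a : Fin 3 → S, ∑ i, a i • θ i = δ) := by
  choose h hh hPhi using exists_h k j
  obtain ⟨d, hd⟩ : ∃ d : ℝ, C d * ((2 * (k + 2 * j + 1) + 3 + 1 : ℕ) : S) = 1 := by
    refine ⟨((2 * (k + 2 * j + 1) + 3 + 1 : ℕ) : ℝ)⁻¹, ?_⟩
    rw [← map_natCast (C : ℝ →+* S), ← C_mul, inv_mul_cancel₀, C_1]
    exact Nat.cast_ne_zero.mpr (Nat.succ_ne_zero _)
  set θ : Fin 3 → Derivation ℝ S S := fun i => Phi k j (ee i) - (C d * h i) • Eul with hθ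
  have hsum : ∀ a : Fin 3 → S, ∑ i, a i • θ i = Phi k j a - (C d * ∑ i, a i * h i) • Eul := by
    intro a
    rw [← Phi_sum]
    simp only [hθ, Fin.sum_univ_three]
    module
  have hmem : ∀ i, θ i ∈ D0 (g3Poly j k) := by
    intro i
    change θ i (g3Poly j k) = 0
    rw [hθ]
    simp only [Derivation.sub_apply, Derivation.smul_apply, smul_eq_mul]
    rw [hPhi, Eul_homog _ _ (g3_homog k j)]
    linear_combination (-h i * g3Poly j k) * hd
  have hsmem : ∀ a : Fin 3 → S, (∑ i, a i • θ i) (g3Poly j k) = 0 := by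
    intro a
    have : ∑ i, a i • θ i ∈ D0 (g3Poly j k) :=
      Submodule.sum_mem _ fun i _ => Submodule.smul_mem _ _ (hmem i)
    exact this
  refine ⟨ell k j, θ, ell_homog k j, ell_indep k j hkj, hmem, ?_, ?_, ?_, ?_⟩
  · intro i m
    have h1 := ((hh i).C_mul d).mul (isHomogeneous_X ℝ m)
    have h2 := (Phi_homog k j i m).sub h1
    simpa [hθ, Derivation.sub_apply, Eul_X] using h2
  · intro v w hvw
    have := congrFun hvw 0
    exact mul_left_cancel₀ (Ld_ne _) this
  · intro a
    rw [← Phi_eq_zero]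
    constructor
    · intro h0
      have h1 := hsum a
      rw [h0] at h1
      have h2 := DFunLike.congr_fun h1 (X 2)
      simp only [Derivation.sub_apply, Derivation.smul_apply, Phi_2, Eul_X, smul_eq_mul,
        Derivation.zero_apply] at h2
      have h3 : C d * ∑ i, a i * h i = 0 := by
        apply mul_right_cancel₀ (ne_zero_of_eval (X 2 : S) ![0, 0, 1] (by simp))
        linear_combination h2
      rw [h3, zero_smul, sub_zero] at h1
      exact h1.symm
    · intro h0
      have h1 : ∑ i, a i • θ i = (-(C d * ∑ i, a i * h i)) • Eul := by
        rw [hsum, h0]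
        module
      have h2 := hsmem a
      rw [h1] at h2
      rw [h1, Eul_D0 k j _ h2, zero_smul]
  · intro δ hδ
    obtain ⟨q, c, hc⟩ := exists_Phi k j hkj δ hδ
    refine ⟨c, ?_⟩
    have h1 : δ - ∑ i, c i • θ i = (q + C d * ∑ i, c i * h i) • Eul := by
      rw [hsum, hc]
      module
    have h2 : (δ - ∑ i, c i • θ i) (g3Poly j k) = 0 := by
      rw [Derivation.sub_apply, hsmem, sub_zero]
      exact hδ
    rw [h1] at h2
    rw [Eul_D0 k j _ h2, zero_smul, sub_eq_zero] at h1
    exact h1.symm
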